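/- arXiv:2402.12257 — 2 statements merged into one kernel-verified Lean document; each statement's English description precedes it below -/
import Mathlib

section
/- Let P be a Markov operator on L¹(X,m), let w ∈ L¹(X,m) satisfy w > 0 a.e., and let C = {x ∈ X : Σ_{k=0}^∞ (Pᵏw)(x) = ∞}. Let u : X → [0,∞] be measurable and let (fₖ) be a sequence of nonnegative functions in L¹(X,m) increasing pointwise a.e. to u, and define P u as the a.e. pointwise limit of P fₖ. If P u ≤ u a.e. on C, then P u = u a.e. on C. -/
open MeasureTheory Filter Topology ENNReal

/-- A Markov operator on `L¹(X,m)`, represented by a linear operator on (representatives of)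
functions: it maps integrable functions to integrable functions, is positive
(`f ≥ 0` a.e. implies `P f ≥ 0` a.e.) and is an `L¹`-contraction. -/
def IsMarkovOperator {X : Type*} [MeasurableSpace X] (m : Measure X)
    (P : (X → ℝ) →ₗ[ℝ] (X → ℝ)) : Prop :=
  (∀ f : X → ℝ, Integrable f m → Integrable (P f) m) ∧
  (∀ f : X → ℝ, Integrable f m → 0 ≤ᵐ[m] f → 0 ≤ᵐ[m] P f) ∧
  (∀ f : X → ℝ, Integrable f m → ∫ x, |P f x| ∂m ≤ ∫ x, |f x| ∂m)

/-- The conservative part of `X` for the Markov operator `P`, determined by a strictly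
positive integrable function `w`: the set of points where `∑_{k=0}^∞ (Pᵏ w)(x) = ∞`. -/
def conservativePart {X : Type*} [MeasurableSpace X]
    (P : (X → ℝ) →ₗ[ℝ] (X → ℝ)) (w : X → ℝ) : Set X :=
  {x : X | (∑' k : ℕ, ENNReal.ofReal ((P ^ k) w x)) = ⊤}

namespace IsMarkovOperator

variable {X : Type*} [MeasurableSpace X] {m : Measure X} {P : (X → ℝ) →ₗ[ℝ] (X → ℝ)}

lemma mono (hP : IsMarkovOperator m P) {f g : X → ℝ} (hf : Integrable f m)
    (hg : Integrable g m) (hfg : f ≤ᵐ[m] g) : P f ≤ᵐ[m] P g := by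
  have h := hP.2.1 (g - f) (hg.sub hf) (by
    filter_upwards [hfg] with x hx
    simpa using hx)
  filter_upwards [h] with x hx
  simpa using hx

lemma integral_le (hP : IsMarkovOperator m P) {f : X → ℝ} (hf : Integrable f m)
    (hf0 : 0 ≤ᵐ[m] f) : ∫ x, P f x ∂m ≤ ∫ x, f x ∂m := by
  calc ∫ x, P f x ∂m = ∫ x, |P f x| ∂m := integral_congr_ae (by
        filter_upwards [hP.2.1 f hf hf0] with x hx
        exact (abs_of_nonneg hx).symm)
    _ ≤ ∫ x, |f x| ∂m := hP.2.2 f hf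
    _ = ∫ x, f x ∂m := integral_congr_ae (by
        filter_upwards [hf0] with x hx
        exact abs_of_nonneg hx)

lemma integrable_pow (hP : IsMarkovOperator m P) {f : X → ℝ} (hf : Integrable f m) (k : ℕ) :
    Integrable ((P ^ k) f) m := by
  induction k with
  | zero => simpa using hf
  | succ k ih =>
    rw [pow_succ']
    exact hP.1 _ ih

lemma pow_nonneg (hP : IsMarkovOperator m P) {f : X → ℝ} (hf : Integrable f m)
    (hf0 : 0 ≤ᵐ[m] f) (k : ℕ) : 0 ≤ᵐ[m] (P ^ k) f := by
  induction k with
  | zero => simpa using hf0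
  | succ k ih =>
    rw [pow_succ']
    exact hP.2.1 _ (hP.integrable_pow hf k) ih

end IsMarkovOperator

/-- The partial sum `∑_{k < n} Pᵏ f`. -/
def orbitSum {X : Type*} (P : (X → ℝ) →ₗ[ℝ] (X → ℝ)) (n : ℕ) (f : X → ℝ) : X → ℝ :=
  ∑ k ∈ Finset.range n, (P ^ k) f

lemma orbitSum_zero {X : Type*} (P : (X → ℝ) →ₗ[ℝ] (X → ℝ)) (f : X → ℝ) :
    orbitSum P 0 f = 0 := by
  simp [orbitSum]

lemma orbitSum_succ {X : Type*} (P : (X → ℝ) →ₗ[ℝ] (X → ℝ)) (n : ℕ) (f : X → ℝ) :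
    orbitSum P (n + 1) f = f + P (orbitSum P n f) := by
  simp only [orbitSum, Finset.sum_range_succ', map_sum, pow_succ', pow_zero]
  rw [add_comm]
  rfl

lemma orbitSum_sub_smul {X : Type*} (P : (X → ℝ) →ₗ[ℝ] (X → ℝ)) (n : ℕ) (f g : X → ℝ) (a : ℝ) :
    orbitSum P n (f - a • g) = orbitSum P n f - a • orbitSum P n g := by
  simp [orbitSum, Finset.sum_sub_distrib, Finset.smul_sum]

/-- The positive parts `M₀ = 0`, `Mₙ₊₁ = (f + P Mₙ)⁺` occurring in Garsia's proof of the
maximal ergodic lemma. -/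
def maximalSum {X : Type*} (P : (X → ℝ) →ₗ[ℝ] (X → ℝ)) (f : X → ℝ) : ℕ → X → ℝ
  | 0 => 0
  | n + 1 => fun x => max (f x + P (maximalSum P f n) x) 0

lemma maximalSum_nonneg {X : Type*} (P : (X → ℝ) →ₗ[ℝ] (X → ℝ)) (f : X → ℝ) (n : ℕ) (x : X) :
    0 ≤ maximalSum P f n x := by
  cases n with
  | zero => exact le_rfl
  | succ n => exact le_max_right _ _

namespace IsMarkovOperator

variable {X : Type*} [MeasurableSpace X] {m : Measure X} {P : (X → ℝ) →ₗ[ℝ] (X → ℝ)}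

lemma integrable_orbitSum (hP : IsMarkovOperator m P) {f : X → ℝ} (hf : Integrable f m)
    (n : ℕ) : Integrable (orbitSum P n f) m :=
  integrable_finsetSum' _ fun k _ => hP.integrable_pow hf k

lemma ofReal_orbitSum (hP : IsMarkovOperator m P) {f : X → ℝ} (hf : Integrable f m)
    (hf0 : 0 ≤ᵐ[m] f) : ∀ᵐ x ∂m, ∀ n, ENNReal.ofReal (orbitSum P n f x) =
      ∑ k ∈ Finset.range n, ENNReal.ofReal ((P ^ k) f x) := by
  filter_upwards [ae_all_iff.2 (hP.pow_nonneg hf hf0)] with x hx n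
  rw [orbitSum, Finset.sum_apply, ENNReal.ofReal_sum_of_nonneg fun k _ => hx k]

lemma orbitSum_nonneg (hP : IsMarkovOperator m P) {f : X → ℝ} (hf : Integrable f m)
    (hf0 : 0 ≤ᵐ[m] f) (n : ℕ) : 0 ≤ᵐ[m] orbitSum P n f := by
  filter_upwards [ae_all_iff.2 (hP.pow_nonneg hf hf0)] with x hx
  rw [orbitSum, Finset.sum_apply]
  exact Finset.sum_nonneg fun k _ => hx k

lemma tendsto_ofReal_orbitSum (hP : IsMarkovOperator m P) {f : X → ℝ} (hf : Integrable f m)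
    (hf0 : 0 ≤ᵐ[m] f) : ∀ᵐ x ∂m, Tendsto (fun n => ENNReal.ofReal (orbitSum P n f x)) atTop
      (𝓝 (∑' k, ENNReal.ofReal ((P ^ k) f x))) := by
  filter_upwards [hP.ofReal_orbitSum hf hf0] with x hx
  simpa only [hx] using ENNReal.tendsto_nat_tsum fun k => ENNReal.ofReal ((P ^ k) f x)

lemma aemeasurable_tsum (hP : IsMarkovOperator m P) {f : X → ℝ} (hf : Integrable f m) :
    AEMeasurable (fun x => ∑' k, ENNReal.ofReal ((P ^ k) f x)) m :=
  AEMeasurable.tsum fun k => (hP.integrable_pow hf k).aemeasurable.ennreal_ofReal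

lemma nullMeasurableSet_conservativePart (hP : IsMarkovOperator m P) {f : X → ℝ}
    (hf : Integrable f m) : NullMeasurableSet (conservativePart P f) m :=
  (hP.aemeasurable_tsum hf).nullMeasurableSet_preimage (measurableSet_singleton ⊤)

/-- Monotone continuity of a Markov operator: if `h` is dominated by the limit of `fₖ`, then
`P h` is dominated by the supremum of `P fₖ`. -/
lemma ofReal_le_iSup (hP : IsMarkovOperator m P) {h : X → ℝ} {f : ℕ → X → ℝ}
    (hh : Integrable h m) (hh0 : 0 ≤ᵐ[m] h) (hf : ∀ k, Integrable (f k) m)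
    (hf0 : ∀ k, 0 ≤ᵐ[m] f k)
    (hlim : ∀ᵐ x ∂m, Tendsto (fun k => max (h x - f k x) 0) atTop (𝓝 0)) :
    ∀ᵐ x ∂m, ENNReal.ofReal (P h x) ≤ ⨆ k, ENNReal.ofReal (P (f k) x) := by
  set d : ℕ → X → ℝ := fun k x => max (h x - f k x) 0 with hd
  have hdI : ∀ k, Integrable (d k) m := fun k => (hh.sub (hf k)).pos_part
  have hd0 : ∀ k, 0 ≤ᵐ[m] d k := fun k => Eventually.of_forall fun x => le_max_right _ _
  have hPd0 : ∀ k, 0 ≤ᵐ[m] P (d k) := fun k => hP.2.1 _ (hdI k) (hd0 k)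
  have hint : Tendsto (fun k => ∫ x, d k x ∂m) atTop (𝓝 0) := by
    have := tendsto_integral_of_dominated_convergence (F := d) (f := fun _ => (0 : ℝ)) h
      (fun k => (hdI k).aestronglyMeasurable) hh (fun k => by
        filter_upwards [hf0 k, hh0] with x hx hx'
        rw [Real.norm_of_nonneg (le_max_right _ _)]
        simp only [Pi.zero_apply] at hx hx'
        exact max_le (by linarith) hx') hlim
    simpa using this
  have hlint : ∫⁻ x, ⨅ k, ENNReal.ofReal (P (d k) x) ∂m = 0 := by
    refine le_antisymm (ge_of_tendsto' (x := atTop)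
      (f := fun k => ENNReal.ofReal (∫ x, d k x ∂m)) ?_ fun k => ?_) zero_le
    · simpa using ENNReal.tendsto_ofReal hint
    · calc ∫⁻ x, ⨅ k, ENNReal.ofReal (P (d k) x) ∂m
          ≤ ∫⁻ x, ENNReal.ofReal (P (d k) x) ∂m := lintegral_mono fun x => iInf_le _ k
        _ = ENNReal.ofReal (∫ x, P (d k) x ∂m) :=
            (ofReal_integral_eq_lintegral_ofReal (hP.1 _ (hdI k)) (hPd0 k)).symm
        _ ≤ _ := ENNReal.ofReal_le_ofReal (hP.integral_le (hdI k) (hd0 k))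
  have hinf := (lintegral_eq_zero_iff' (AEMeasurable.iInf fun k =>
    (hP.1 _ (hdI k)).aemeasurable.ennreal_ofReal)).1 hlint
  have hle : ∀ k, P h ≤ᵐ[m] P (f k + d k) := fun k =>
    hP.mono hh ((hf k).add (hdI k)) (Eventually.of_forall fun x => by
      have : h x - f k x ≤ d k x := le_max_left _ _
      simp only [Pi.add_apply]
      linarith)
  filter_upwards [hinf, ae_all_iff.2 hle] with x hx hlex
  have hb : ∀ k, ENNReal.ofReal (P h x) ≤
      (⨆ k, ENNReal.ofReal (P (f k) x)) + ENNReal.ofReal (P (d k) x) := fun k => by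
    have := hlex k
    rw [map_add, Pi.add_apply] at this
    refine (ENNReal.ofReal_le_ofReal this).trans (ENNReal.ofReal_add_le.trans ?_)
    gcongr
    exact le_iSup (fun k => ENNReal.ofReal (P (f k) x)) k
  have hx' : ⨅ k, ENNReal.ofReal (P (d k) x) = 0 := hx
  calc ENNReal.ofReal (P h x)
      ≤ ⨅ k, ((⨆ k, ENNReal.ofReal (P (f k) x)) + ENNReal.ofReal (P (d k) x)) := le_iInf hb
    _ = ⨆ k, ENNReal.ofReal (P (f k) x) := by rw [← ENNReal.add_iInf, hx', add_zero]

/-- The conservative part is absorbing. -/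
lemma eq_zero_off_conservativePart (hP : IsMarkovOperator m P) {w h : X → ℝ}
    (hw : Integrable w m) (hw0 : 0 ≤ᵐ[m] w) (hh : Integrable h m) (hh0 : 0 ≤ᵐ[m] h)
    (hsupp : ∀ᵐ x ∂m, x ∉ conservativePart P w → h x = 0) :
    ∀ᵐ x ∂m, x ∉ conservativePart P w → P h x = 0 := by
  have key : ∀ N : ℕ, ∀ᵐ x ∂m, ENNReal.ofReal (P ((N : ℝ) • h) x) ≤
      ⨆ k, ENNReal.ofReal (P (orbitSum P k w) x) := fun N => by
    refine hP.ofReal_le_iSup (hh.smul (N : ℝ)) ?_ (hP.integrable_orbitSum hw)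
      (hP.orbitSum_nonneg hw hw0) ?_
    · filter_upwards [hh0] with x hx
      exact mul_nonneg N.cast_nonneg hx
    · filter_upwards [hsupp, hP.tendsto_ofReal_orbitSum hw hw0,
        ae_all_iff.2 (hP.orbitSum_nonneg hw hw0)] with x hx ht hS
      refine tendsto_const_nhds.congr' ?_
      by_cases hxC : x ∈ conservativePart P w
      · rw [show (∑' k, ENNReal.ofReal ((P ^ k) w x)) = ⊤ from hxC] at ht
        filter_upwards [ht.eventually (lt_mem_nhds
          (ENNReal.ofReal_lt_top (r := ((N : ℝ) • h) x)))] with k hk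
        have := (ENNReal.ofReal_lt_ofReal_iff'.1 hk).1
        rw [max_eq_right (by linarith)]
      · refine Eventually.of_forall fun k => ?_
        have := hS k
        simp only [Pi.zero_apply] at this
        simp [hx hxC, this]
  filter_upwards [ae_all_iff.2 key, hP.2.1 h hh hh0, hw0, hP.ofReal_orbitSum hw hw0]
    with x hk hPh hwx hS hxC
  have hG : ⨆ k, ENNReal.ofReal (P (orbitSum P k w) x) ≠ ⊤ := by
    refine ne_top_of_le_ne_top hxC (iSup_le fun k => ?_)
    refine le_trans ?_ (ENNReal.sum_le_tsum (Finset.range (k + 1)))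
    rw [← hS, orbitSum_succ]
    exact ENNReal.ofReal_le_ofReal (le_add_of_nonneg_left hwx)
  by_contra hne
  have hpos : 0 < P h x := lt_of_le_of_ne hPh (Ne.symm hne)
  obtain ⟨N, hN⟩ := exists_nat_gt
    ((⨆ k, ENNReal.ofReal (P (orbitSum P k w) x)).toReal / P h x)
  have h1 := hk N
  rw [map_smul, Pi.smul_apply, smul_eq_mul, ENNReal.ofReal_le_iff_le_toReal hG] at h1
  rw [div_lt_iff₀ hpos] at hN
  linarith

lemma integrable_maximalSum (hP : IsMarkovOperator m P) {f : X → ℝ} (hf : Integrable f m)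
    (n : ℕ) : Integrable (maximalSum P f n) m := by
  induction n with
  | zero => exact integrable_zero _ _ _
  | succ n ih => exact (hf.add (hP.1 _ ih)).pos_part

lemma maximalSum_le_succ (hP : IsMarkovOperator m P) {f : X → ℝ} (hf : Integrable f m) (n : ℕ) :
    maximalSum P f n ≤ᵐ[m] maximalSum P f (n + 1) := by
  induction n with
  | zero => exact Eventually.of_forall fun x => maximalSum_nonneg P f 1 x
  | succ n ih =>
    filter_upwards [hP.mono (hP.integrable_maximalSum hf n)
      (hP.integrable_maximalSum hf (n + 1)) ih] with x hx
    exact max_le_max (by linarith) le_rfl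

lemma orbitSum_le_maximalSum (hP : IsMarkovOperator m P) {f : X → ℝ} (hf : Integrable f m)
    (n : ℕ) : orbitSum P n f ≤ᵐ[m] maximalSum P f n := by
  induction n with
  | zero => rw [orbitSum_zero]; rfl
  | succ n ih =>
    filter_upwards [hP.mono (hP.integrable_orbitSum hf n) (hP.integrable_maximalSum hf n) ih]
      with x hx
    rw [orbitSum_succ]
    exact (add_le_add_right hx _).trans (le_max_left _ _)

/-- The maximal ergodic lemma (Hopf, Garsia). -/
lemma integral_indicator_maximalSum_nonneg (hP : IsMarkovOperator m P) {f : X → ℝ}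
    (hf : Integrable f m) (n : ℕ) :
    0 ≤ ∫ x, {x | 0 < maximalSum P f n x}.indicator f x ∂m := by
  cases n with
  | zero => simp [maximalSum]
  | succ n =>
    have hM := hP.integrable_maximalSum hf n
    have hM' := hP.integrable_maximalSum hf (n + 1)
    have hE : NullMeasurableSet {x | 0 < maximalSum P f (n + 1) x} m :=
      nullMeasurableSet_lt aemeasurable_const hM'.aemeasurable
    calc 0 ≤ ∫ x, maximalSum P f (n + 1) x ∂m - ∫ x, P (maximalSum P f n) x ∂m := by
          have h1 := hP.integral_le hM (Eventually.of_forall (maximalSum_nonneg P f n))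
          have h2 := integral_mono_ae hM hM' (hP.maximalSum_le_succ hf n)
          linarith
      _ = ∫ x, (maximalSum P f (n + 1) x - P (maximalSum P f n) x) ∂m :=
          (integral_sub hM' (hP.1 _ hM)).symm
      _ ≤ _ := by
          refine integral_mono_ae (hM'.sub (hP.1 _ hM)) (hf.indicator₀ hE) ?_
          filter_upwards [hP.2.1 _ hM (Eventually.of_forall (maximalSum_nonneg P f n))] with x hx
          simp only [Pi.zero_apply] at hx
          by_cases hxE : 0 < maximalSum P f (n + 1) x
          · rw [Set.indicator_of_mem (by exact hxE)]
            have h3 : maximalSum P f (n + 1) x = f x + P (maximalSum P f n) x := by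
              simp only [maximalSum, lt_max_iff, lt_self_iff_false, or_false] at hxE ⊢
              exact max_eq_left hxE.le
            linarith
          · rw [Set.indicator_of_notMem (by exact hxE)]
            linarith

/-- On the conservative part, the orbit sums of a nonnegative integrable `g` diverge wherever
`g` is positive. -/
lemma eq_zero_of_tsum_ne_top (hP : IsMarkovOperator m P) {w g : X → ℝ}
    (hw : Integrable w m) (hw0 : 0 ≤ᵐ[m] w) (hg : Integrable g m) (hg0 : 0 ≤ᵐ[m] g) :
    ∀ᵐ x ∂m, x ∈ conservativePart P w → x ∉ conservativePart P g → g x = 0 := by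
  set A := conservativePart P w \ conservativePart P g with hA
  have hAm : NullMeasurableSet A m := (hP.nullMeasurableSet_conservativePart hw).diff
    (hP.nullMeasurableSet_conservativePart hg)
  set I := ∫⁻ x, A.indicator (fun x => ENNReal.ofReal (g x)) x ∂m with hI
  have hbound : ∀ a : ℕ, a * I ≤ ENNReal.ofReal (∫ x, w x ∂m) := fun a => by
    have hF : Integrable (w - (a : ℝ) • g) m := hw.sub (hg.smul _)
    set M := maximalSum P (w - (a : ℝ) • g) with hM
    have hE : ∀ n, NullMeasurableSet {x | 0 < M n x} m := fun n =>
      nullMeasurableSet_lt aemeasurable_const (hP.integrable_maximalSum hF n).aemeasurable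
    have hag : Integrable (fun x => a * g x) m := hg.const_mul _
    have hn : ∀ n, ∫⁻ x, ENNReal.ofReal ({x | 0 < M n x}.indicator (fun x => a * g x) x) ∂m ≤
        ENNReal.ofReal (∫ x, w x ∂m) := fun n => by
      rw [← ofReal_integral_eq_lintegral_ofReal (hag.indicator₀ (hE n))]
      · refine ENNReal.ofReal_le_ofReal ?_
        have h1 := hP.integral_indicator_maximalSum_nonneg hF n
        have h2 : ∫ x, {x | 0 < M n x}.indicator (w - (a : ℝ) • g) x ∂m ≤
            ∫ x, (w x - {x | 0 < M n x}.indicator (fun x => a * g x) x) ∂m := by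
          refine integral_mono_ae (hF.indicator₀ (hE n)) (hw.sub (hag.indicator₀ (hE n))) ?_
          filter_upwards [hw0] with x hx
          by_cases hxE : x ∈ {x | 0 < M n x}
          · simp [Set.indicator_of_mem hxE]
          · simpa [Set.indicator_of_notMem hxE] using hx
        rw [integral_sub hw (hag.indicator₀ (hE n))] at h2
        linarith
      · filter_upwards [hg0] with x hx
        exact Set.indicator_apply_nonneg fun _ => mul_nonneg a.cast_nonneg hx
    calc a * I = ∫⁻ x, a * A.indicator (fun x => ENNReal.ofReal (g x)) x ∂m :=
          (lintegral_const_mul' _ _ (ENNReal.natCast_ne_top a)).symm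
      _ ≤ ∫⁻ x, liminf (fun n =>
            ENNReal.ofReal ({x | 0 < M n x}.indicator (fun x => a * g x) x)) atTop ∂m := by
          refine lintegral_mono_ae ?_
          filter_upwards [hP.tendsto_ofReal_orbitSum hw hw0, hP.tendsto_ofReal_orbitSum hg hg0,
            ae_all_iff.2 (hP.orbitSum_le_maximalSum hF)] with x hxw hxg hxM
          by_cases hxA : x ∈ A
          · rw [Set.indicator_of_mem hxA]
            refine le_liminf_of_le (by isBoundedDefault) ?_
            obtain ⟨hx1, hx2⟩ := hxA
            rw [show (∑' k, ENNReal.ofReal ((P ^ k) w x)) = ⊤ from hx1] at hxw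
            have hx2' : (∑' k, ENNReal.ofReal ((P ^ k) g x)) ≠ ⊤ := hx2
            obtain ⟨c, hc⟩ := exists_gt ((∑' k, ENNReal.ofReal ((P ^ k) g x)).toReal)
            have hc0 : 0 < c := ENNReal.toReal_nonneg.trans_lt hc
            filter_upwards [hxw.eventually (lt_mem_nhds (ENNReal.ofReal_lt_top (r := a * c))),
              hxg.eventually (gt_mem_nhds ((ENNReal.lt_ofReal_iff_toReal_lt hx2').2 hc))]
              with n h1 h2
            have h3 := (ENNReal.ofReal_lt_ofReal_iff'.1 h1).1
            have h4 := (ENNReal.ofReal_lt_ofReal_iff'.1 h2).1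
            have h5 : 0 < M n x := by
              refine lt_of_lt_of_le ?_ (hxM n)
              rw [orbitSum_sub_smul]
              simp only [Pi.sub_apply, Pi.smul_apply, smul_eq_mul]
              have := mul_le_mul_of_nonneg_left h4.le (Nat.cast_nonneg (α := ℝ) a)
              linarith
            rw [Set.indicator_of_mem (by exact h5), ENNReal.ofReal_mul a.cast_nonneg,
              ENNReal.ofReal_natCast]
          · simp [Set.indicator_of_notMem hxA]
      _ ≤ liminf (fun n => ∫⁻ x, ENNReal.ofReal
            ({x | 0 < M n x}.indicator (fun x => a * g x) x) ∂m) atTop :=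
          lintegral_liminf_le' fun n => (hag.indicator₀ (hE n)).aemeasurable.ennreal_ofReal
      _ ≤ ENNReal.ofReal (∫ x, w x ∂m) :=
          (liminf_le_liminf (Eventually.of_forall hn)).trans (by simp)
  have hI0 : I = 0 := by
    by_contra hne
    obtain ⟨a, ha⟩ := ENNReal.exists_nat_mul_gt hne
      (ENNReal.ofReal_ne_top (r := ∫ x, w x ∂m))
    exact absurd (hbound a) (not_le.2 ha)
  have hz := (lintegral_eq_zero_iff'
    (hg.aemeasurable.ennreal_ofReal.indicator₀ hAm)).1 hI0
  filter_upwards [hz, hg0] with x hx hgx h1 h2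
  rw [Set.indicator_of_mem (show x ∈ A from ⟨h1, h2⟩)] at hx
  exact le_antisymm (ENNReal.ofReal_eq_zero.1 hx) hgx

end IsMarkovOperator

/-- If `u : X → [0,∞]` is measurable, `(fₖ)` is a sequence of nonnegative `L¹` functions
increasing pointwise a.e. to `u`, and `Pu` is the a.e. pointwise limit of `P fₖ`
(the extension of `P` to nonnegative measurable functions), then `Pu ≤ u` a.e. on the
conservative part `C` implies `Pu = u` a.e. on `C`. -/
theorem extension_eq_on_conservative_of_le
    {X : Type*} [MeasurableSpace X] (m : Measure X) [SigmaFinite m]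
    (P : (X → ℝ) →ₗ[ℝ] (X → ℝ)) (hP : IsMarkovOperator m P)
    (w : X → ℝ) (hwInt : Integrable w m) (hwPos : ∀ᵐ x ∂m, 0 < w x)
    (u : X → ℝ≥0∞) (hu : Measurable u)
    (f : ℕ → X → ℝ) (hfInt : ∀ k, Integrable (f k) m) (hfPos : ∀ k, 0 ≤ᵐ[m] f k)
    (hfMono : ∀ᵐ x ∂m, Monotone fun k => f k x)
    (hfLim : ∀ᵐ x ∂m, Tendsto (fun k => ENNReal.ofReal (f k x)) atTop (𝓝 (u x)))
    (Pu : X → ℝ≥0∞)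
    (hPu : ∀ᵐ x ∂m, Tendsto (fun k => ENNReal.ofReal (P (f k) x)) atTop (𝓝 (Pu x)))
    (hle : ∀ᵐ x ∂m, x ∈ conservativePart P w → Pu x ≤ u x) :
    ∀ᵐ x ∂m, x ∈ conservativePart P w → Pu x = u x := by
  set C := conservativePart P w with hC
  have hw0 : 0 ≤ᵐ[m] w := hwPos.mono fun x hx => hx.le
  have hPuM : AEMeasurable Pu m := aemeasurable_of_tendsto_metrizable_ae atTop
    (fun k => (hP.1 _ (hfInt k)).aemeasurable.ennreal_ofReal) hPu
  set g : X → ℝ := C.indicator fun x => (min (ENNReal.ofReal (w x)) (u x - Pu x)).toReal with hg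
  have hgM : AEMeasurable g m :=
    ((hwInt.aemeasurable.ennreal_ofReal.min (hu.aemeasurable.sub hPuM)).ennreal_toReal).indicator₀
      (hP.nullMeasurableSet_conservativePart hwInt)
  have hg0' : ∀ x, 0 ≤ g x := fun x => Set.indicator_apply_nonneg fun _ => ENNReal.toReal_nonneg
  have hg0 : 0 ≤ᵐ[m] g := Eventually.of_forall hg0'
  have hgInt : Integrable g m := by
    refine hwInt.mono' hgM.aestronglyMeasurable ?_
    filter_upwards [hw0] with x hx
    rw [Real.norm_of_nonneg (hg0' x)]
    refine Set.indicator_apply_le' (fun _ => ?_) fun _ => hx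
    exact ENNReal.toReal_le_of_le_ofReal hx (min_le_left _ _)
  have hgle : ∀ x ∈ C, ENNReal.ofReal (g x) = min (ENNReal.ofReal (w x)) (u x - Pu x) :=
    fun x hx => by
      rw [hg, Set.indicator_of_mem hx, ENNReal.ofReal_toReal]
      exact ne_top_of_le_ne_top ENNReal.ofReal_ne_top (min_le_left _ _)
  have hdom : ∀ h : X → ℝ, Integrable h m → 0 ≤ᵐ[m] h →
      (∀ᵐ x ∂m, ENNReal.ofReal (h x) ≤ u x) → ∀ᵐ x ∂m, ENNReal.ofReal (P h x) ≤ Pu x := by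
    intro h hh hh0 hhu
    have hPmono : ∀ k, P (f k) ≤ᵐ[m] P (f (k + 1)) := fun k =>
      hP.mono (hfInt k) (hfInt (k + 1)) (hfMono.mono fun x hx => hx k.le_succ)
    have hlim : ∀ᵐ x ∂m, Tendsto (fun k => max (h x - f k x) 0) atTop (𝓝 0) := by
      filter_upwards [hh0, hhu, hfLim, ae_all_iff.2 hfPos] with x hx0 hxu hxl hfx
      have h1 : Tendsto (fun k => ENNReal.ofReal (h x) - ENNReal.ofReal (f k x)) atTop
          (𝓝 (ENNReal.ofReal (h x) - u x)) :=
        ENNReal.Tendsto.sub tendsto_const_nhds hxl (Or.inl ENNReal.ofReal_ne_top)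
      rw [tsub_eq_zero_of_le hxu] at h1
      have h2 := (ENNReal.tendsto_toReal ENNReal.zero_ne_top).comp h1
      refine (ENNReal.toReal_zero ▸ h2).congr fun k => ?_
      simp only [Function.comp_apply]
      rw [← ENNReal.ofReal_sub _ (hfx k), ENNReal.toReal_ofReal']
    filter_upwards [hP.ofReal_le_iSup hh hh0 hfInt hfPos hlim, hPu, ae_all_iff.2 hPmono]
      with x hx hxP hxm
    have hmon : Monotone fun k => ENNReal.ofReal (P (f k) x) :=
      monotone_nat_of_le_succ fun k => ENNReal.ofReal_le_ofReal (hxm k)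
    rwa [iSup_eq_of_tendsto hmon hxP] at hx
  have hSI := hP.integrable_orbitSum hgInt
  have hS0 := hP.orbitSum_nonneg hgInt hg0
  have hsum : ∀ n, (∀ᵐ x ∂m, ENNReal.ofReal (orbitSum P n g x) ≤ u x) ∧
      ∀ᵐ x ∂m, x ∉ C → orbitSum P n g x = 0 := by
    intro n
    induction n with
    | zero => simp [orbitSum_zero]
    | succ n ih =>
      have hoff : ∀ᵐ x ∂m, x ∉ C → orbitSum P (n + 1) g x = 0 := by
        filter_upwards [hP.eq_zero_off_conservativePart hwInt hw0 (hSI n) (hS0 n) ih.2]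
          with x hx hxC
        rw [orbitSum_succ, Pi.add_apply, hx hxC, hg, Set.indicator_of_notMem hxC, add_zero]
      refine ⟨?_, hoff⟩
      filter_upwards [hoff, hdom _ (hSI n) (hS0 n) ih.1, hle] with x hx hxd hxle
      by_cases hxC : x ∈ C
      · rw [orbitSum_succ, Pi.add_apply]
        calc ENNReal.ofReal (g x + P (orbitSum P n g) x)
            ≤ ENNReal.ofReal (g x) + ENNReal.ofReal (P (orbitSum P n g) x) :=
              ENNReal.ofReal_add_le
          _ ≤ (u x - Pu x) + Pu x :=
              add_le_add ((hgle x hxC).trans_le (min_le_right _ _)) hxd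
          _ = u x := tsub_add_cancel_of_le (hxle hxC)
      · simp [hx hxC]
  filter_upwards [hP.eq_zero_of_tsum_ne_top hwInt hw0 hgInt hg0, hle, hwPos,
    ae_all_iff.2 fun n => hdom _ (hSI n) (hS0 n) (hsum n).1,
    hP.tendsto_ofReal_orbitSum hgInt hg0] with x hx hxle hwx hxd hxt hxC
  refine le_antisymm (hxle hxC) (not_lt.1 fun hlt => ?_)
  have hfin : x ∉ conservativePart P g := by
    have hbd : ∑' k, ENNReal.ofReal ((P ^ k) g x) ≤ ENNReal.ofReal (g x) + Pu x := by
      refine le_of_tendsto' ((tendsto_add_atTop_iff_nat 1).2 hxt) fun n => ?_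
      rw [orbitSum_succ, Pi.add_apply]
      exact ENNReal.ofReal_add_le.trans (add_le_add_right (hxd n) _)
    exact ne_top_of_le_ne_top (ENNReal.add_ne_top.2 ⟨ENNReal.ofReal_ne_top, hlt.ne_top⟩) hbd
  have h1 := hgle x hxC
  rw [hx hxC hfin, ENNReal.ofReal_zero] at h1
  have h2 : 0 < min (ENNReal.ofReal (w x)) (u x - Pu x) :=
    lt_min (ENNReal.ofReal_pos.2 hwx) (tsub_pos_of_lt hlt)
  exact h2.ne h1
end

section
/- Let K, N ≥ 1 and for k = 1, …, K let M_k = diag(m_k(1), …, m_k(N)) with m_k(i) ∈ (0,1), Σ_{k=1}^K m_k(i)² = 1 for every i, and m_k(i₁) ≠ m_k(i₂) for every k whenever i₁ ≠ i₂. Define ρ(φ) = Π_{i=1}^N |φ_i|⁻². Then for every φ ∈ ℂ^N with ‖φ‖ = 1 all of whose components are nonzero and which has at least two nonzero components (i.e., N ≥ 2), Σ_{k=1}^K (|det(M_k⁻¹)|² / ‖M_k⁻¹φ‖^{2N+2}) ρ(M_k⁻¹φ/‖M_k⁻¹φ‖) = (Σ_{k=1}^K 1/‖M_k⁻¹φ‖²)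 · ρ(φ) < ρ(φ); that is, ρ is properly subinvariant for the Frobenius–Perron operator of the quantum non-demolition measurement process at every such φ. -/
open Finset

/-- The Lyapunov density `ρ(φ) = ∏ᵢ |φᵢ|⁻²` on `ℂ^N`. -/
noncomputable def lyapDensity {N : ℕ} (φ : Fin N → ℂ) : ℝ :=
  (∏ i : Fin N, ‖φ i‖ ^ 2)⁻¹

/-- The strict weighted harmonic–arithmetic mean inequality for positive weights. -/
theorem one_div_sum_div_lt_sum_mul {ι : Type*} [Fintype ι] {w x : ι → ℝ}
    (hw : ∀ i, 0 < w i) (hw1 : ∑ i, w i = 1) (hx : ∀ i, 0 < x i)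
    (hne : ∃ i j, x i ≠ x j) :
    1 / ∑ i, w i / x i < ∑ i, w i * x i := by
  obtain ⟨i, j, hij⟩ := hne
  have h := (strictConvexOn_zpow (m := -1) (by norm_num) (by norm_num)).map_sum_lt
    (t := Finset.univ) (w := w) (p := fun i => (x i)⁻¹) (fun i _ => hw i) hw1
    (fun i _ => inv_pos.2 (hx i))
    ⟨i, Finset.mem_univ i, j, Finset.mem_univ j, fun h => hij (inv_injective h)⟩
  simpa [div_eq_mul_inv] using h

/-- The Lyapunov density scales by `|det M|² s^{2N}` under `φ ↦ M⁻¹φ / s`, for `M` diagonal. -/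
theorem lyapDensity_div_div {N : ℕ} (φ : Fin N → ℂ) (a : Fin N → ℝ) (s : ℝ) :
    lyapDensity (fun i => φ i / (a i : ℂ) / (s : ℂ))
      = (∏ i, a i ^ 2) * s ^ (2 * N) * lyapDensity φ := by
  simp only [lyapDensity, norm_div, Complex.norm_real, div_pow, Real.norm_eq_abs, sq_abs,
    Finset.prod_div_distrib, Finset.prod_const, Finset.card_univ, Fintype.card_fin, inv_div,
    ← pow_mul]
  rw [div_div_eq_mul_div, div_eq_mul_inv]
  ring

theorem lyapDensity_pos {N : ℕ} {φ : Fin N → ℂ} (hφ : ∀ i, φ i ≠ 0) : 0 < lyapDensity φ :=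
  inv_pos.2 (Finset.prod_pos fun i _ => pow_pos (norm_pos_iff.2 (hφ i)) 2)

/-- For `M_k = diag(m_k(1), …, m_k(N))` with `m_k(i) ∈ (0,1)`, `∑ₖ m_k(i)² = 1`, and
`m_k(i₁) ≠ m_k(i₂)` for `i₁ ≠ i₂`, the density `ρ(φ) = ∏ᵢ|φᵢ|⁻²` satisfies, at every unit
vector `φ` with all components nonzero (and `N ≥ 2`),
`∑ₖ (|det M_k⁻¹|²/‖M_k⁻¹φ‖^{2N+2}) ρ(M_k⁻¹φ/‖M_k⁻¹φ‖) = (∑ₖ 1/‖M_k⁻¹φ‖²)·ρ(φ) < ρ(φ)`: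
`ρ` is properly subinvariant for the Frobenius–Perron operator of the quantum
non-demolition measurement process. -/
theorem lyapDensity_properly_subinvariant
    {K N : ℕ} (hK : 1 ≤ K) (hN : 2 ≤ N)
    (m : Fin K → Fin N → ℝ)
    (hm : ∀ k i, m k i ∈ Set.Ioo (0 : ℝ) 1)
    (hsum : ∀ i, ∑ k : Fin K, (m k i) ^ 2 = 1)
    (hinj : ∀ k : Fin K, ∀ i j : Fin N, i ≠ j → m k i ≠ m k j)
    (φ : Fin N → ℂ) (hφnorm : ∑ i : Fin N, ‖φ i‖ ^ 2 = 1)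
    (hall : ∀ i, φ i ≠ 0) :
    (∑ k : Fin K,
        (∏ i : Fin N, ((m k i) ^ 2)⁻¹) /
            (Real.sqrt (∑ i : Fin N, ‖φ i‖ ^ 2 / (m k i) ^ 2)) ^ (2 * N + 2) *
          lyapDensity (fun i =>
            φ i / (m k i : ℂ) / (Real.sqrt (∑ i : Fin N, ‖φ i‖ ^ 2 / (m k i) ^ 2) : ℂ)))
      = (∑ k : Fin K, 1 / (∑ i : Fin N, ‖φ i‖ ^ 2 / (m k i) ^ 2)) * lyapDensity φ ∧
    (∑ k : Fin K, 1 / (∑ i : Fin N, ‖φ i‖ ^ 2 / (m k i) ^ 2)) * lyapDensity φ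
      < lyapDensity φ := by
  have hm0 : ∀ k i, 0 < m k i := fun k i => (hm k i).1
  have hw : ∀ i, 0 < ‖φ i‖ ^ 2 := fun i => pow_pos (norm_pos_iff.2 (hall i)) 2
  let i₀ : Fin N := ⟨0, by omega⟩
  let i₁ : Fin N := ⟨1, by omega⟩
  have hi : i₀ ≠ i₁ := by simp [i₀, i₁]
  have hS : ∀ k, 0 < ∑ i : Fin N, ‖φ i‖ ^ 2 / (m k i) ^ 2 := fun k =>
    Finset.sum_pos (fun i _ => div_pos (hw i) (pow_pos (hm0 k i) 2)) ⟨i₀, Finset.mem_univ _⟩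
  constructor
  · rw [Finset.sum_mul]
    refine Finset.sum_congr rfl fun k _ => ?_
    rw [lyapDensity_div_div, Finset.prod_inv_distrib, pow_add, Real.sq_sqrt (hS k).le]
    have hs := (Real.sqrt_pos.2 (hS k)).ne'
    have hp : ∏ i, m k i ^ 2 ≠ 0 := Finset.prod_ne_zero_iff.2 fun i _ => (pow_pos (hm0 k i) 2).ne'
    have hSk := (hS k).ne'
    generalize Real.sqrt (∑ i : Fin N, ‖φ i‖ ^ 2 / (m k i) ^ 2) = s at *
    generalize ∑ i : Fin N, ‖φ i‖ ^ 2 / (m k i) ^ 2 = S at *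
    field_simp
  · refine mul_lt_of_lt_one_left (lyapDensity_pos hall) ?_
    calc ∑ k, 1 / ∑ i, ‖φ i‖ ^ 2 / m k i ^ 2
        < ∑ k, ∑ i, ‖φ i‖ ^ 2 * m k i ^ 2 :=
          Finset.sum_lt_sum_of_nonempty ⟨⟨0, hK⟩, Finset.mem_univ _⟩ fun k _ =>
            one_div_sum_div_lt_sum_mul hw hφnorm (fun i => pow_pos (hm0 k i) 2)
              ⟨i₀, i₁, fun h => hinj k _ _ hi
                ((pow_left_inj₀ (hm0 k _).le (hm0 k _).le two_ne_zero).1 h)⟩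
      _ = 1 := by
          rw [Finset.sum_comm]
          simp only [← Finset.mul_sum, hsum, mul_one, hφnorm]
end
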